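/- Fix an integer m ≥ 1, an arbitrary set Y of real sequences, and an infinite matrix A = (a_{nk}). Suppose that for each n and k the series d_{nk} = Σ_{j=k}^{∞} a_{nj} B_{jk} converges, where B is the inverse triangle of H^(m), and let D = (d_{nk}). Then A ∈ (h_c(Δ^(m)) : Y) if and only if the n-th row (a_{nk})_k of A belongs to the β-dual of h_c(Δ^(m)) for every n and D ∈ (c : Y). -/

import Mathlib

open Filter Finset Topology

/- Real sequences are modelled as functions `ℕ → ℝ`, where the Lean index `n : ℕ`
corresponds to the paper's index `n + 1` (the paper indexes sequences by `k ≥ 1`).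
Thus the paper's entry `h_{nk} = ∑_{i=k}^{n} (-1)^{i-k} C(m, i-k) / (n+i-1)`
(for `1 ≤ k ≤ n`) becomes, with 0-based indices,
`hMat m n k = ∑_{i ∈ Icc k n} (-1)^{i-k} C(m, i-k) / (n+i+1)`. -/

/-- The entries of the triangle matrix `H^(m) = H Δ^(m)` (0-based indexing). -/
noncomputable def hMat (m n k : ℕ) : ℝ :=
  ∑ i ∈ Finset.Icc k n, (-1 : ℝ) ^ (i - k) * (Nat.choose m (i - k) : ℝ) / ((n + i + 1 : ℕ) : ℝ)

/-- The `H^(m)`-transform of a sequence: `(H^(m) x)_n = ∑_{k=1}^{n} h_{nk} x_k`. -/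
noncomputable def hTrans (m : ℕ) (x : ℕ → ℝ) (n : ℕ) : ℝ :=
  ∑ k ∈ Finset.range (n + 1), hMat m n k * x k

/-- `h_0(Δ^(m))`: sequences whose `H^(m)`-transform tends to `0`. -/
def hZero (m : ℕ) : Set (ℕ → ℝ) := {x | Tendsto (hTrans m x) atTop (𝓝 0)}

/-- `h_c(Δ^(m))`: sequences whose `H^(m)`-transform converges. -/
def hConv (m : ℕ) : Set (ℕ → ℝ) := {x | ∃ L : ℝ, Tendsto (hTrans m x) atTop (𝓝 L)}

/-- `h_∞(Δ^(m))`: sequences whose `H^(m)`-transform is bounded. -/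
def hBdd (m : ℕ) : Set (ℕ → ℝ) := {x | ∃ M : ℝ, ∀ n, |hTrans m x n| ≤ M}

/-- The space `c₀` of null real sequences. -/
def c0Seq : Set (ℕ → ℝ) := {y | Tendsto y atTop (𝓝 0)}

/-- The space `c` of convergent real sequences. -/
def cSeq : Set (ℕ → ℝ) := {y | ∃ L : ℝ, Tendsto y atTop (𝓝 L)}

/-- The space `ℓ∞` of bounded real sequences. -/
def linfSeq : Set (ℕ → ℝ) := {y | ∃ M : ℝ, ∀ n, |y n| ≤ M}

/-- The sup norm `‖y‖ = sup_n |y_n|` of a sequence. -/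
noncomputable def supNorm (y : ℕ → ℝ) : ℝ := ⨆ n, |y n|

/-- The norm `‖x‖ = sup_n |(H^(m) x)_n|` on the Hilbert difference sequence spaces. -/
noncomputable def hNorm (m : ℕ) (x : ℕ → ℝ) : ℝ := supNorm (hTrans m x)

/-- `A ∈ (X : Y)`: for every `x ∈ X` each row-series `∑_k a_{nk} x_k` converges and the
sequence of the sums belongs to `Y`. -/
def matClass (A : ℕ → ℕ → ℝ) (X Y : Set (ℕ → ℝ)) : Prop :=
  ∀ x ∈ X, ∃ Ax : ℕ → ℝ,
    (∀ n, Tendsto (fun K => ∑ k ∈ Finset.range K, A n k * x k) atTop (𝓝 (Ax n))) ∧ Ax ∈ Y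

/-- The β-dual of a set of real sequences. -/
def betaDual (X : Set (ℕ → ℝ)) : Set (ℕ → ℝ) :=
  {a | ∀ x ∈ X, ∃ L : ℝ, Tendsto (fun K => ∑ k ∈ Finset.range K, a k * x k) atTop (𝓝 L)}

/-! ### Bounded functionals on null sequences -/

theorem aux_steinhaus (c : ℕ → ℕ → ℝ)
    (hconv : ∀ y : ℕ → ℝ, Tendsto y atTop (𝓝 0) →
      ∃ L : ℝ, Tendsto (fun K => ∑ j ∈ Finset.range K, c K j * y j) atTop (𝓝 L)) :
    ∃ M : ℝ, ∀ K, ∀ y : ℕ → ℝ, Tendsto y atTop (𝓝 0) → ∀ C : ℝ, 0 ≤ C → (∀ j, |y j| ≤ C) →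
      |∑ j ∈ Finset.range K, c K j * y j| ≤ M * C := by
  have hle : ∀ (f : ZeroAtInftyContinuousMap ℕ ℝ) (j : ℕ), |f j| ≤ ‖f‖ := by
    intro f j
    rw [← ZeroAtInftyContinuousMap.norm_toBCF_eq_norm]
    exact f.toBCF.norm_coe_le_norm j
  have hlin : ∀ K, ∃ T : ZeroAtInftyContinuousMap ℕ ℝ →L[ℝ] ℝ,
      ∀ f, T f = ∑ j ∈ Finset.range K, c K j * f j := by
    intro K
    let T0 : ZeroAtInftyContinuousMap ℕ ℝ →ₗ[ℝ] ℝ :=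
      { toFun := fun f => ∑ j ∈ Finset.range K, c K j * f j
        map_add' := by
          intro f g
          simp [mul_add, Finset.sum_add_distrib]
        map_smul' := by
          intro a f
          simp only [ZeroAtInftyContinuousMap.smul_apply, smul_eq_mul, RingHom.id_apply,
            Finset.mul_sum]
          exact Finset.sum_congr rfl fun j _ => by ring }
    refine ⟨T0.mkContinuous (∑ j ∈ Finset.range K, |c K j|) ?_, fun f => rfl⟩
    intro f
    change |∑ j ∈ Finset.range K, c K j * f j| ≤ _
    rw [Finset.sum_mul]
    refine (Finset.abs_sum_le_sum_abs _ _).trans (Finset.sum_le_sum fun j _ => ?_)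
    rw [abs_mul]
    exact mul_le_mul_of_nonneg_left (hle f j) (abs_nonneg _)
  choose T hT using hlin
  have hb : ∀ f, ∃ C, ∀ K, ‖T K f‖ ≤ C := by
    intro f
    have hf : Tendsto (fun j => f j) atTop (𝓝 0) := by
      have := f.zero_at_infty'
      rw [cocompact_eq_cofinite, Nat.cofinite_eq_atTop] at this
      exact this
    obtain ⟨L, hL⟩ := hconv _ hf
    obtain ⟨C, hC⟩ := (Metric.isBounded_range_of_tendsto _ hL).exists_norm_le
    refine ⟨C, fun K => ?_⟩
    rw [hT]
    exact hC _ ⟨K, rfl⟩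
  obtain ⟨M, hM⟩ := banach_steinhaus hb
  refine ⟨M, fun K y hy C hC0 hC => ?_⟩
  let f : ZeroAtInftyContinuousMap ℕ ℝ :=
    { toFun := y
      continuous_toFun := continuous_of_discreteTopology
      zero_at_infty' := by
        rw [cocompact_eq_cofinite, Nat.cofinite_eq_atTop]
        exact hy }
  have hfn : ‖f‖ ≤ C := by
    rw [← ZeroAtInftyContinuousMap.norm_toBCF_eq_norm]
    exact (BoundedContinuousFunction.norm_le hC0).2 hC
  have h1 : |∑ j ∈ Finset.range K, c K j * y j| = ‖T K f‖ := by
    rw [hT]; rfl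
  rw [h1]
  have hM0 : 0 ≤ M := (norm_nonneg _).trans (hM K)
  calc ‖T K f‖ ≤ ‖T K‖ * ‖f‖ := (T K).le_opNorm f
    _ ≤ M * C := mul_le_mul (hM K) hfn (norm_nonneg _) hM0

theorem aux_null (c : ℕ → ℕ → ℝ) (d : ℕ → ℝ)
    (hd : ∀ j, Tendsto (fun K => c K j) atTop (𝓝 (d j)))
    (hconv : ∀ y : ℕ → ℝ, Tendsto y atTop (𝓝 0) →
      ∃ L : ℝ, Tendsto (fun K => ∑ j ∈ Finset.range K, c K j * y j) atTop (𝓝 L)) :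
    Summable (fun j => |d j|) ∧ ∀ y : ℕ → ℝ, Tendsto y atTop (𝓝 0) →
      Tendsto (fun K => ∑ j ∈ Finset.range K, c K j * y j) atTop (𝓝 (∑' j, d j * y j)) := by
  obtain ⟨M, hM⟩ := aux_steinhaus c hconv
  -- finite sections
  have hfin : ∀ N, ∀ y : ℕ → ℝ, Tendsto (fun K => ∑ j ∈ Finset.range K,
      c K j * (if j < N then y j else 0)) atTop (𝓝 (∑ j ∈ Finset.range N, d j * y j)) := by
    intro N y
    have h1 : Tendsto (fun K => ∑ j ∈ Finset.range N, c K j * y j) atTop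
        (𝓝 (∑ j ∈ Finset.range N, d j * y j)) :=
      tendsto_finsetSum _ fun j _ => (hd j).mul_const _
    refine h1.congr' ?_
    filter_upwards [eventually_ge_atTop N] with K hK
    rw [← Finset.sum_subset (Finset.range_mono hK)]
    · refine Finset.sum_congr rfl fun j hj => ?_
      rw [if_pos (Finset.mem_range.1 hj)]
    · intro j _ hj
      rw [if_neg (by simpa using hj), mul_zero]
  have hz : ∀ N, ∀ y : ℕ → ℝ, Tendsto (fun j => if j < N then y j else 0) atTop (𝓝 0) := by
    intro N y
    refine tendsto_const_nhds.congr' ?_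
    filter_upwards [eventually_ge_atTop N] with j hj
    rw [if_neg (by omega)]
  have hbd : ∀ N, ∀ y : ℕ → ℝ, ∀ C : ℝ, 0 ≤ C → (∀ j, |y j| ≤ C) →
      |∑ j ∈ Finset.range N, d j * y j| ≤ M * C := by
    intro N y C hC0 hC
    refine le_of_tendsto (hfin N y).abs (Eventually.of_forall fun K => ?_)
    refine hM K _ (hz N y) C hC0 fun j => ?_
    split_ifs
    · exact hC j
    · simpa using hC0
  have hs : Summable (fun j => |d j|) := by
    refine summable_of_sum_range_le (c := M * 1) (fun j => abs_nonneg _) fun N => ?_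
    have h := hbd N (fun j => SignType.sign (d j)) 1 zero_le_one (fun j => by
      rcases lt_trichotomy (d j) 0 with h | h | h <;> simp [h])
    have h2 : ∑ j ∈ Finset.range N, d j * ((SignType.sign (d j) : SignType) : ℝ)
        = ∑ j ∈ Finset.range N, |d j| :=
      Finset.sum_congr rfl fun j _ => by rw [mul_comm, sign_mul_self]
    rw [h2] at h
    exact (le_abs_self _).trans h
  refine ⟨hs, fun y hy => ?_⟩
  obtain ⟨L, hL⟩ := hconv y hy
  obtain ⟨C, hC⟩ := (Metric.isBounded_range_of_tendsto _ hy).exists_norm_le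
  have hsum : Summable (fun j => d j * y j) := by
    refine Summable.of_norm_bounded (g := fun j => |d j| * C) (hs.mul_right C) fun j => ?_
    rw [norm_mul]
    exact mul_le_mul_of_nonneg_left (hC _ ⟨j, rfl⟩) (abs_nonneg _)
  have hN := hsum.hasSum.tendsto_sum_nat
  have hLN : Tendsto (fun N => ∑ j ∈ Finset.range N, d j * y j) atTop (𝓝 L) := by
    have hM0 : 0 ≤ M := by
      have := hM 0 (fun _ => 0) tendsto_const_nhds 1 zero_le_one (by simp)
      simpa using this
    rw [Metric.tendsto_atTop]
    intro ε hε
    have hδ : 0 < ε / (2 * (M + 1)) := by positivity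
    obtain ⟨N0, hN0⟩ := (Metric.tendsto_atTop.1 hy) _ hδ
    refine ⟨N0, fun N hN => ?_⟩
    have hlim := ((hfin N y).sub hL).abs
    have : |∑ j ∈ Finset.range N, d j * y j - L| ≤ M * (ε / (2 * (M + 1))) := by
      refine le_of_tendsto hlim (Eventually.of_forall fun K => ?_)
      rw [← Finset.sum_sub_distrib]
      have h3 := hM K (fun j => (if j < N then y j else 0) - y j)
        (by simpa using (hz N y).sub hy) _ hδ.le (fun j => by
          by_cases hj : j < N
          · simp [hj, hδ.le]
          · have := hN0 j (by omega)
            rw [Real.dist_eq, sub_zero] at this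
            simpa [hj] using this.le)
      simpa [mul_sub] using h3
    rw [Real.dist_eq]
    refine this.trans_lt ?_
    rw [mul_div_assoc', div_lt_iff₀ (by positivity)]
    nlinarith
  rw [tendsto_nhds_unique hN hLN]
  exact hL

/-! ### The transform in terms of power series -/

theorem aux_coeff (m k : ℕ) :
    PowerSeries.coeff k ((1 - PowerSeries.X : PowerSeries ℝ) ^ m)
      = (-1 : ℝ) ^ k * (Nat.choose m k : ℝ) := by
  induction m generalizing k with
  | zero => cases k <;> simp [PowerSeries.coeff_one]
  | succ m ih =>
    rw [pow_succ, mul_sub, mul_one, map_sub]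
    cases k with
    | zero => simp [ih]
    | succ k =>
      rw [PowerSeries.coeff_succ_mul_X, ih, ih, Nat.choose_succ_succ]
      push_cast
      ring

theorem aux_hTrans (m : ℕ) (w : ℕ → ℝ) (n : ℕ) :
    hTrans m w n = ∑ i ∈ Finset.range (n + 1),
      PowerSeries.coeff i ((1 - PowerSeries.X : PowerSeries ℝ) ^ m * PowerSeries.mk w)
        / ((n + i + 1 : ℕ) : ℝ) := by
  have h1 : ∀ i, PowerSeries.coeff i
      ((1 - PowerSeries.X : PowerSeries ℝ) ^ m * PowerSeries.mk w)
      = ∑ k ∈ Finset.range (i + 1), (-1 : ℝ) ^ (i - k) * (Nat.choose m (i - k) : ℝ) * w k := by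
    intro i
    rw [mul_comm, PowerSeries.coeff_mul, Finset.Nat.sum_antidiagonal_eq_sum_range_succ_mk]
    refine Finset.sum_congr rfl fun k _ => ?_
    rw [aux_coeff, PowerSeries.coeff_mk]
    ring
  simp_rw [h1, hTrans, hMat, Finset.sum_mul, Finset.sum_div]
  rw [Finset.sum_comm']
  · refine Finset.sum_congr rfl fun i _ => Finset.sum_congr rfl fun k _ => ?_
    ring
  · intro k i
    simp only [Finset.mem_range, Finset.mem_Icc]
    omega

theorem aux_step (r : ℝ) (hr0 : 0 ≤ r) (hr1 : r ≤ 1) (g p : PowerSeries ℝ) (C : ℝ)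
    (hg : g * (1 - PowerSeries.C r * PowerSeries.X) = 1)
    (hp : ∀ k, |PowerSeries.coeff k p| ≤ C) (k : ℕ) :
    |PowerSeries.coeff k ((1 - PowerSeries.X) * g * p)| ≤ 2 * C := by
  set u := g * p with hu
  have hrec : u = p + PowerSeries.C r * (u * PowerSeries.X) := by
    have : u * (1 - PowerSeries.C r * PowerSeries.X) = p := by
      rw [hu]
      calc g * p * (1 - PowerSeries.C r * PowerSeries.X)
          = (g * (1 - PowerSeries.C r * PowerSeries.X)) * p := by ring
        _ = p := by rw [hg, one_mul]
    linear_combination this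
  have h0 : PowerSeries.coeff 0 u = PowerSeries.coeff 0 p := by
    conv_lhs => rw [hrec]
    simp
  have hs : ∀ k, PowerSeries.coeff (k + 1) u
      = PowerSeries.coeff (k + 1) p + r * PowerSeries.coeff k u := by
    intro k
    conv_lhs => rw [hrec]
    rw [map_add, PowerSeries.coeff_C_mul, PowerSeries.coeff_succ_mul_X]
  have hC : 0 ≤ C := (abs_nonneg _).trans (hp 0)
  have hub : ∀ k, (1 - r) * |PowerSeries.coeff k u| ≤ C := by
    intro k
    induction k with
    | zero =>
      rw [h0]
      have := hp 0
      have := abs_nonneg (PowerSeries.coeff 0 p)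
      nlinarith
    | succ k ih =>
      rw [hs]
      have h1 := abs_add_le (PowerSeries.coeff (k + 1) p) (r * PowerSeries.coeff k u)
      rw [abs_mul, abs_of_nonneg hr0] at h1
      have h2 := hp (k + 1)
      calc _ ≤ (1 - r) * (C + r * |PowerSeries.coeff k u|) :=
            mul_le_mul_of_nonneg_left (by linarith) (by linarith)
        _ = (1 - r) * C + r * ((1 - r) * |PowerSeries.coeff k u|) := by ring
        _ ≤ (1 - r) * C + r * C := by
            have := mul_le_mul_of_nonneg_left ih hr0
            linarith
        _ = C := by ring
  have he : (1 - PowerSeries.X) * g * p = u - u * PowerSeries.X := by rw [hu]; ring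
  rw [he, map_sub]
  cases k with
  | zero =>
    have := hp 0
    rw [h0, PowerSeries.coeff_zero_mul_X, sub_zero]
    linarith
  | succ k =>
    rw [PowerSeries.coeff_succ_mul_X, hs]
    have h3 : PowerSeries.coeff (k + 1) p + r * PowerSeries.coeff k u - PowerSeries.coeff k u
      = PowerSeries.coeff (k + 1) p - (1 - r) * PowerSeries.coeff k u := by ring
    rw [h3]
    refine (abs_sub _ _).trans ?_
    rw [abs_mul, abs_of_nonneg (by linarith : 0 ≤ 1 - r)]
    linarith [hp (k + 1), hub k]

theorem aux_bound (r : ℝ) (hr0 : 0 ≤ r) (hr1 : r ≤ 1) (m k : ℕ) :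
    |PowerSeries.coeff k ((1 - PowerSeries.X : PowerSeries ℝ) ^ m *
      PowerSeries.mk (fun k => r ^ k * (Nat.choose (m + k) m : ℝ)))| ≤ 2 ^ m := by
  set g : PowerSeries ℝ := PowerSeries.rescale r (PowerSeries.mk 1) with hgdef
  have hg : g * (1 - PowerSeries.C r * PowerSeries.X) = 1 := by
    have := congrArg (PowerSeries.rescale r) (PowerSeries.mk_one_mul_one_sub_eq_one ℝ)
    rwa [map_mul, map_sub, map_one, PowerSeries.rescale_X] at this
  have hmk : PowerSeries.mk (fun k => r ^ k * (Nat.choose (m + k) m : ℝ)) = g ^ (m + 1) := by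
    rw [hgdef, ← map_pow, PowerSeries.mk_one_pow_eq_mk_choose_add]
    ext k
    rw [PowerSeries.coeff_rescale, PowerSeries.coeff_mk, PowerSeries.coeff_mk]
  have hind : ∀ m k, |PowerSeries.coeff k ((1 - PowerSeries.X : PowerSeries ℝ) ^ m * g ^ (m + 1))|
      ≤ 2 ^ m := by
    intro m
    induction m with
    | zero =>
      intro k
      simp only [pow_zero, one_mul, zero_add, pow_one, hgdef, PowerSeries.coeff_rescale,
        PowerSeries.coeff_mk, Pi.one_apply, mul_one]
      rw [abs_of_nonneg (by positivity)]
      exact pow_le_one₀ hr0 hr1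
    | succ m ih =>
      intro k
      have := aux_step r hr0 hr1 g _ _ hg ih k
      rw [pow_succ' (2 : ℝ)]
      convert this using 3
      ring
  rw [hmk]
  exact hind m k

theorem aux_hTrans_bound (r : ℝ) (hr0 : 0 ≤ r) (hr1 : r ≤ 1) (m n : ℕ) :
    |hTrans m (fun k => r ^ k * (Nat.choose (m + k) m : ℝ)) n| ≤ 2 ^ m := by
  rw [aux_hTrans]
  refine (Finset.abs_sum_le_sum_abs _ _).trans ?_
  calc _ ≤ ∑ i ∈ Finset.range (n + 1), (2 : ℝ) ^ m / ((n + 1 : ℕ) : ℝ) := by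
        refine Finset.sum_le_sum fun i _ => ?_
        rw [abs_div, Nat.abs_cast]
        refine div_le_div₀ (by positivity) (aux_bound r hr0 hr1 m i) (by positivity) ?_
        exact_mod_cast (by omega)
    _ = 2 ^ m := by
        rw [Finset.sum_const, Finset.card_range, nsmul_eq_mul]
        field_simp

/-- The reference sequence has transform with a positive limit. -/
theorem aux_star (m : ℕ) : ∃ L : ℝ, 0 < L ∧
    Tendsto (hTrans m (fun k => (Nat.choose (m + k) m : ℝ))) atTop (𝓝 L) := by
  have h1 : ∀ n, hTrans m (fun k => (Nat.choose (m + k) m : ℝ)) n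
      = ∑ i ∈ Finset.range (n + 1), 1 / ((n + i + 1 : ℕ) : ℝ) := by
    intro n
    rw [aux_hTrans]
    refine Finset.sum_congr rfl fun i _ => ?_
    rw [← PowerSeries.mk_one_pow_eq_mk_choose_add, pow_succ, ← mul_assoc, ← mul_pow,
      mul_comm (1 - PowerSeries.X), PowerSeries.mk_one_mul_one_sub_eq_one]
    simp
  have hanti : Antitone (hTrans m (fun k => (Nat.choose (m + k) m : ℝ))) := by
    refine antitone_nat_of_succ_le fun n => ?_
    rw [h1, h1, Finset.sum_range_succ, Finset.sum_range_succ, Finset.sum_range_succ']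
    have h2 : ∑ i ∈ Finset.range n, 1 / ((n + 1 + i + 1 : ℕ) : ℝ)
      = ∑ i ∈ Finset.range n, 1 / ((n + (i + 1) + 1 : ℕ) : ℝ) :=
      Finset.sum_congr rfl fun i _ => by rw [show n + 1 + i + 1 = n + (i + 1) + 1 by ring]
    rw [h2]
    have h3 : 1 / ((n + 1 + n + 1 : ℕ) : ℝ) + 1 / ((n + 1 + (n + 1) + 1 : ℕ) : ℝ)
        ≤ 1 / ((n + 0 + 1 : ℕ) : ℝ) := by
      have ha : 1 / ((n + 1 + (n + 1) + 1 : ℕ) : ℝ) ≤ 1 / ((n + 1 + n + 1 : ℕ) : ℝ) :=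
        one_div_le_one_div_of_le (by positivity) (by exact_mod_cast (by omega))
      have hb : 1 / ((n + 1 + n + 1 : ℕ) : ℝ) + 1 / ((n + 1 + n + 1 : ℕ) : ℝ)
          = 1 / ((n + 0 + 1 : ℕ) : ℝ) := by
        push_cast
        field_simp
        ring
      linarith
    linarith
  have hlow : ∀ n, (1 / 2 : ℝ) ≤ hTrans m (fun k => (Nat.choose (m + k) m : ℝ)) n := by
    intro n
    rw [h1]
    calc (1 / 2 : ℝ) = ∑ i ∈ Finset.range (n + 1), 1 / ((2 * (n + 1) : ℕ) : ℝ) := by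
          rw [Finset.sum_const, Finset.card_range, nsmul_eq_mul]
          push_cast
          field_simp
      _ ≤ _ := by
          refine Finset.sum_le_sum fun i hi => ?_
          have := Finset.mem_range.1 hi
          exact one_div_le_one_div_of_le (by positivity) (by exact_mod_cast (by omega))
  have ht := tendsto_atTop_ciInf hanti ⟨1 / 2, by rintro _ ⟨n, rfl⟩; exact hlow n⟩
  exact ⟨_, lt_of_lt_of_le (by norm_num : (0 : ℝ) < 1 / 2)
    (ge_of_tendsto ht (Eventually.of_forall hlow)), ht⟩

theorem aux_hMat_bound (m n k : ℕ) : |hMat m n k| ≤ (∑ i ∈ Finset.range (m + 1),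
    (Nat.choose m i : ℝ)) / ((n + 1 : ℕ) : ℝ) := by
  have h1 : hMat m n k = ∑ i ∈ Finset.range (n + 1 - k),
      (-1 : ℝ) ^ i * (Nat.choose m i : ℝ) / ((n + (k + i) + 1 : ℕ) : ℝ) := by
    rw [hMat, ← Finset.Ico_add_one_right_eq_Icc, Finset.sum_Ico_eq_sum_range]
    simp
  rw [h1]
  refine (Finset.abs_sum_le_sum_abs _ _).trans ?_
  rw [Finset.sum_div]
  have h2 : ∀ i, |(-1 : ℝ) ^ i * (Nat.choose m i : ℝ) / ((n + (k + i) + 1 : ℕ) : ℝ)|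
      ≤ (Nat.choose m i : ℝ) / ((n + 1 : ℕ) : ℝ) := by
    intro i
    rw [abs_div, abs_mul, abs_pow, abs_neg, abs_one, one_pow, one_mul, Nat.abs_cast, Nat.abs_cast]
    exact div_le_div_of_nonneg_left (by positivity) (by positivity)
      (by exact_mod_cast (by omega))
  refine (Finset.sum_le_sum fun i _ => h2 i).trans ?_
  calc _ ≤ ∑ i ∈ Finset.range (n + 1 - k + (m + 1)), (Nat.choose m i : ℝ) / ((n + 1 : ℕ) : ℝ) :=
        Finset.sum_le_sum_of_subset_of_nonneg (Finset.range_mono (by omega))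
          fun i _ _ => by positivity
    _ = _ := by
        symm
        refine Finset.sum_subset (Finset.range_mono (by omega)) fun i _ hi => ?_
        rw [Nat.choose_eq_zero_of_lt (by simpa using hi)]
        simp

/-- The transform of an absolutely summable sequence is a null sequence. -/
theorem aux_summable_null (m : ℕ) (w : ℕ → ℝ) (hw : Summable fun k => |w k|) :
    Tendsto (hTrans m w) atTop (𝓝 0) := by
  set S : ℝ := ∑ i ∈ Finset.range (m + 1), (Nat.choose m i : ℝ)
  have hlim : Tendsto (fun n : ℕ => S * (∑' k, |w k|) / ((n + 1 : ℕ) : ℝ)) atTop (𝓝 0) :=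
    (tendsto_const_div_atTop_nhds_zero_nat (S * ∑' k, |w k|)).comp (tendsto_add_atTop_nat 1)
  refine squeeze_zero_norm (fun n => ?_) hlim
  rw [Real.norm_eq_abs, hTrans]
  refine (Finset.abs_sum_le_sum_abs _ _).trans ?_
  calc _ ≤ ∑ k ∈ Finset.range (n + 1), S / ((n + 1 : ℕ) : ℝ) * |w k| := by
        refine Finset.sum_le_sum fun k _ => ?_
        rw [abs_mul]
        exact mul_le_mul_of_nonneg_right (aux_hMat_bound m n k) (abs_nonneg _)
    _ = S / ((n + 1 : ℕ) : ℝ) * ∑ k ∈ Finset.range (n + 1), |w k| := by rw [Finset.mul_sum]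
    _ ≤ S / ((n + 1 : ℕ) : ℝ) * ∑' k, |w k| := by
        refine mul_le_mul_of_nonneg_left (hw.sum_le_tsum _ fun i _ => abs_nonneg _) ?_
        positivity
    _ = _ := by ring

/-! ### Inversion -/

theorem aux_inv_right (m : ℕ) (B : ℕ → ℕ → ℝ)
    (hBright : ∀ n k : ℕ, (∑ j ∈ Finset.Icc k n, hMat m n j * B j k) = if n = k then 1 else 0)
    (y : ℕ → ℝ) (n : ℕ) :
    hTrans m (fun k => ∑ j ∈ Finset.range (k + 1), B k j * y j) n = y n := by
  rw [hTrans]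
  simp_rw [Finset.mul_sum]
  rw [Finset.sum_comm' (t' := Finset.range (n + 1)) (s' := fun j => Finset.Icc j n)]
  · have : ∀ j ∈ Finset.range (n + 1), ∑ k ∈ Finset.Icc j n, hMat m n k * (B k j * y j)
        = if n = j then y j else 0 := by
      intro j _
      simp_rw [← mul_assoc]
      rw [← Finset.sum_mul, hBright]
      split_ifs <;> simp
    rw [Finset.sum_congr rfl this]
    simp
  · intro k j
    simp only [Finset.mem_range, Finset.mem_Icc]
    omega

theorem aux_inv_left (m : ℕ) (B : ℕ → ℕ → ℝ)
    (hBleft : ∀ n k : ℕ, (∑ j ∈ Finset.Icc k n, B n j * hMat m j k) = if n = k then 1 else 0)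
    (x : ℕ → ℝ) (n : ℕ) :
    ∑ j ∈ Finset.range (n + 1), B n j * hTrans m x j = x n := by
  simp_rw [hTrans, Finset.mul_sum]
  rw [Finset.sum_comm' (t' := Finset.range (n + 1)) (s' := fun j => Finset.Icc j n)]
  · have : ∀ j ∈ Finset.range (n + 1), ∑ k ∈ Finset.Icc j n, B n k * (hMat m k j * x j)
        = if n = j then x j else 0 := by
      intro j _
      simp_rw [← mul_assoc]
      rw [← Finset.sum_mul, hBleft]
      split_ifs <;> simp
    rw [Finset.sum_congr rfl this]
    simp
  · intro k j
    simp only [Finset.mem_range, Finset.mem_Icc]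
    omega

/-! ### The key identity -/

theorem aux_key (m : ℕ) (B : ℕ → ℕ → ℝ)
    (hBtri : ∀ n k : ℕ, n < k → B n k = 0)
    (hBright : ∀ n k : ℕ, (∑ j ∈ Finset.Icc k n, hMat m n j * B j k) = if n = k then 1 else 0)
    (hBleft : ∀ n k : ℕ, (∑ j ∈ Finset.Icc k n, B n j * hMat m j k) = if n = k then 1 else 0)
    (a d : ℕ → ℝ)
    (hd : ∀ k : ℕ, Tendsto (fun J => ∑ j ∈ Finset.Icc k J, a j * B j k) atTop (𝓝 (d k)))
    (ha : a ∈ betaDual (hConv m)) (x : ℕ → ℝ) (hx : x ∈ hConv m) :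
    ∃ L : ℝ, Tendsto (fun K => ∑ k ∈ Finset.range K, a k * x k) atTop (𝓝 L) ∧
      Tendsto (fun K => ∑ k ∈ Finset.range K, d k * hTrans m x k) atTop (𝓝 L) := by
  set c : ℕ → ℕ → ℝ := fun K j => ∑ k ∈ Finset.range K, a k * B k j with hc
  -- partial sums in terms of the transform
  have hpart : ∀ (w : ℕ → ℝ) (K : ℕ), ∑ k ∈ Finset.range K, a k * w k
      = ∑ j ∈ Finset.range K, c K j * hTrans m w j := by
    intro w K
    simp_rw [hc, Finset.sum_mul]
    rw [Finset.sum_comm]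
    refine Finset.sum_congr rfl fun k hk => ?_
    rw [← aux_inv_left m B hBleft w k, Finset.mul_sum]
    have hk' := Finset.mem_range.1 hk
    rw [← Finset.sum_subset (Finset.range_mono (by omega : k + 1 ≤ K))]
    · refine Finset.sum_congr rfl fun j _ => ?_
      ring
    · intro j _ hj
      rw [hBtri k j (by simpa using hj)]
      simp
  have hcd : ∀ j, Tendsto (fun K => c K j) atTop (𝓝 (d j)) := by
    intro j
    rw [← tendsto_add_atTop_iff_nat 1]
    refine (hd j).congr fun J => ?_
    refine Finset.sum_subset (fun k hk => ?_) fun k hk hk' => ?_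
    · simp only [Finset.mem_range, Finset.mem_Icc] at *
      omega
    · simp only [Finset.mem_range, Finset.mem_Icc] at *
      rw [hBtri k j (by omega), mul_zero]
  have hconv : ∀ y : ℕ → ℝ, Tendsto y atTop (𝓝 0) →
      ∃ L : ℝ, Tendsto (fun K => ∑ j ∈ Finset.range K, c K j * y j) atTop (𝓝 L) := by
    intro y hy
    have hy' : hTrans m (fun k => ∑ j ∈ Finset.range (k + 1), B k j * y j) = y :=
      funext fun n => aux_inv_right m B hBright y n
    obtain ⟨L, hL⟩ := ha (fun k => ∑ j ∈ Finset.range (k + 1), B k j * y j)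
      ⟨0, by rw [hy']; exact hy⟩
    refine ⟨L, hL.congr fun K => ?_⟩
    rw [hpart, hy']
  obtain ⟨hs, hnull⟩ := aux_null c d hcd hconv
  have hdom : ∀ y : ℕ → ℝ, ∀ C, (∀ j, |y j| ≤ C) → Summable fun j => d j * y j := by
    intro y C hC
    refine Summable.of_norm_bounded (g := fun j => |d j| * C) (hs.mul_right C) fun j => ?_
    rw [norm_mul]
    exact mul_le_mul_of_nonneg_left (hC j) (abs_nonneg _)
  -- the reference sequence
  set q : ℕ → ℝ := fun k => (Nat.choose (m + k) m : ℝ) with hq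
  obtain ⟨Ls, hLs, hqlim⟩ := aux_star m
  have hqb : ∀ j, |hTrans m q j| ≤ 2 ^ m := by
    intro j
    simpa using aux_hTrans_bound 1 zero_le_one le_rfl m j
  obtain ⟨l, hl⟩ := ha q ⟨Ls, hqlim⟩
  have habel := Real.tendsto_tsum_powerSeries_nhdsWithin_lt hl
  have hev : ∀ᶠ r : ℝ in 𝓝[<] 1, 0 < r ∧ r < 1 := by
    filter_upwards [Ioo_mem_nhdsLT (zero_lt_one (α := ℝ))] with r hr using hr
  have hval : ∀ r : ℝ, 0 < r → r < 1 → ∑' n, a n * q n * r ^ n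
      = ∑' j, d j * hTrans m (fun k => r ^ k * q k) j := by
    intro r hr0 hr1
    have hsum : Summable (fun k => |r ^ k * q k|) := by
      have := (summable_choose_mul_geometric_of_norm_lt_one m (r := r)
        (by rwa [Real.norm_eq_abs, abs_of_pos hr0])).abs
      refine this.congr fun k => ?_
      rw [hq, mul_comm, add_comm]
    have h1 := hnull _ (aux_summable_null m _ hsum)
    have h2 : Summable (fun n => a n * q n * r ^ n) := by
      have h0 : Tendsto (fun n => a n * q n) atTop (𝓝 0) := by
        have := (hl.comp (tendsto_add_atTop_nat 1)).sub hl
        simpa [Function.comp_def, Finset.sum_range_succ] using this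
      obtain ⟨C, hC⟩ := (Metric.isBounded_range_of_tendsto _ h0).exists_norm_le
      refine Summable.of_norm_bounded (g := fun n => C * r ^ n)
        ((summable_geometric_of_lt_one hr0.le hr1).mul_left C) fun n => ?_
      rw [norm_mul, norm_pow, Real.norm_of_nonneg hr0.le]
      exact mul_le_mul_of_nonneg_right (hC _ ⟨n, rfl⟩) (by positivity)
    refine tendsto_nhds_unique h2.hasSum.tendsto_sum_nat (h1.congr fun K => ?_)
    rw [← hpart]
    exact Finset.sum_congr rfl fun k _ => by ring
  have hlim2 : Tendsto (fun r : ℝ => ∑' j, d j * hTrans m (fun k => r ^ k * q k) j) (𝓝[<] 1)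
      (𝓝 (∑' j, d j * hTrans m q j)) := by
    refine tendsto_tsum_of_dominated_convergence (bound := fun j => |d j| * 2 ^ m)
      (hs.mul_right _) (fun j => ?_) ?_
    · refine Tendsto.mono_left ?_ nhdsWithin_le_nhds
      have hcont : Continuous fun r : ℝ => d j * hTrans m (fun k => r ^ k * q k) j := by
        unfold hTrans
        fun_prop
      simpa using hcont.tendsto 1
    · filter_upwards [hev] with r hr j
      rw [norm_mul]
      exact mul_le_mul_of_nonneg_left (aux_hTrans_bound r hr.1.le hr.2.le m j) (abs_nonneg _)
  have hqval : l = ∑' j, d j * hTrans m q j := by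
    refine tendsto_nhds_unique (habel.congr' ?_) hlim2
    filter_upwards [hev] with r hr using hval r hr.1 hr.2
  -- the general sequence
  obtain ⟨L, hL⟩ := hx
  set t := L / Ls with ht
  have hy0 : Tendsto (fun j => hTrans m x j - t * hTrans m q j) atTop (𝓝 0) := by
    have := hL.sub (hqlim.const_mul t)
    rwa [ht, div_mul_cancel₀ _ hLs.ne', sub_self] at this
  have h1 := (hnull _ hy0).add (hl.const_mul t)
  obtain ⟨C, hC⟩ := (Metric.isBounded_range_of_tendsto _ hL).exists_norm_le
  have hsx : Summable fun j => d j * hTrans m x j := hdom _ C fun j => hC _ ⟨j, rfl⟩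
  have hsq : Summable fun j => d j * hTrans m q j := hdom _ _ hqb
  have h2 : ∑' j, d j * (hTrans m x j - t * hTrans m q j) + t * l = ∑' j, d j * hTrans m x j := by
    rw [hqval, ← tsum_mul_left, ← Summable.tsum_add]
    · exact tsum_congr fun j => by ring
    · refine (hsx.sub (hsq.mul_left t)).congr fun j => by ring
    · exact hsq.mul_left t
  rw [h2] at h1
  refine ⟨_, h1.congr fun K => ?_, hsx.hasSum.tendsto_sum_nat⟩
  rw [hpart x, hpart q, Finset.mul_sum, ← Finset.sum_add_distrib]
  exact Finset.sum_congr rfl fun j _ => by ring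

/-- `A ∈ (hConv m : Y)` iff every row of `A` lies in the β-dual of `hConv m` and the
matrix `D`, `d_{nk} = ∑_{j=k}^∞ a_{nj} B_{jk}`, satisfies `D ∈ (cSeq : Y)`. -/
theorem hilbert_diff_matrix_from_hc (m : ℕ) (hm : 1 ≤ m) (Y : Set (ℕ → ℝ))
    (A : ℕ → ℕ → ℝ)
    (B : ℕ → ℕ → ℝ)
    (hBtri : ∀ n k : ℕ, n < k → B n k = 0)
    (hBright : ∀ n k : ℕ, (∑ j ∈ Finset.Icc k n, hMat m n j * B j k) = if n = k then 1 else 0)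
    (hBleft : ∀ n k : ℕ, (∑ j ∈ Finset.Icc k n, B n j * hMat m j k) = if n = k then 1 else 0)
    (D : ℕ → ℕ → ℝ)
    (hD : ∀ n k : ℕ,
      Tendsto (fun J => ∑ j ∈ Finset.Icc k J, A n j * B j k) atTop (𝓝 (D n k))) :
    matClass A (hConv m) Y ↔
      ((∀ n : ℕ, (fun k => A n k) ∈ betaDual (hConv m)) ∧ matClass D cSeq Y) := by
  constructor
  · intro hA
    have hrow : ∀ n : ℕ, (fun k => A n k) ∈ betaDual (hConv m) := by
      intro n x hx
      obtain ⟨Ax, h, _⟩ := hA x hx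
      exact ⟨_, h n⟩
    refine ⟨hrow, fun y hy => ?_⟩
    have hy' : hTrans m (fun k => ∑ j ∈ Finset.range (k + 1), B k j * y j) = y :=
      funext fun n => aux_inv_right m B hBright y n
    have hx : (fun k => ∑ j ∈ Finset.range (k + 1), B k j * y j) ∈ hConv m := by
      obtain ⟨L, hL⟩ := hy
      exact ⟨L, by rw [hy']; exact hL⟩
    obtain ⟨Ax, h, hY⟩ := hA _ hx
    refine ⟨Ax, fun n => ?_, hY⟩
    obtain ⟨L, h1, h2⟩ := aux_key m B hBtri hBright hBleft (fun k => A n k) (fun k => D n k)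
      (hD n) (hrow n) _ hx
    rw [hy'] at h2
    rw [tendsto_nhds_unique (h n) h1]
    exact h2
  · rintro ⟨hrow, hDY⟩ x hx
    obtain ⟨Dy, h, hY⟩ := hDY (hTrans m x) hx
    refine ⟨Dy, fun n => ?_, hY⟩
    obtain ⟨L, h1, h2⟩ := aux_key m B hBtri hBright hBleft (fun k => A n k) (fun k => D n k)
      (hD n) (hrow n) x hx
    rw [tendsto_nhds_unique (h n) h2]
    exact h1
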